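/- arXiv:1002.4419 — 4 statements merged into one kernel-verified Lean document; each statement's English description precedes it below -/
import Mathlib

section
/- Let κ be an infinite type (the index set), let n be a natural number, and let A be a maximal antichain in the Cohen forcing notion C(κ) of finite partial functions from κ to 2. Then there is a finite subset L of A such that every condition p ∈ C(κ) whose support has size at most n is compatible with some q ∈ L. -/
namespace Cohen

variable {κ : Type*}

/-- The support of a partial function from `κ` to `2`. -/
def support (p : κ → Option Bool) : Set κ := {a | p a ≠ none}

/-- A Cohen condition: a partial function from `κ` to `2` with finite support. -/
def IsCond (p : κ → Option Bool) : Prop := (support p).Finite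

/-- `q` extends `p`: `q` agrees with `p` wherever `p` is defined. -/
def Extends (q p : κ → Option Bool) : Prop := ∀ a, p a ≠ none → q a = p a

/-- Two conditions are compatible if they have a common extension which is a
condition. -/
def Compatible (p q : κ → Option Bool) : Prop :=
  ∃ r, IsCond r ∧ Extends r p ∧ Extends r q

/-- An antichain in the Cohen forcing notion: a set of conditions which are
pairwise incompatible. -/
def IsAntichain (A : Set (κ → Option Bool)) : Prop :=
  (∀ p ∈ A, IsCond p) ∧ ∀ p ∈ A, ∀ q ∈ A, p ≠ q → ¬Compatible p q

/-- A maximal antichain in the Cohen forcing notion: an antichain such that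
every condition is compatible with some member. -/
def IsMaximalAntichain (A : Set (κ → Option Bool)) : Prop :=
  IsAntichain A ∧ ∀ p, IsCond p → ∃ q ∈ A, Compatible p q

end Cohen

namespace Cohen

variable {κ : Type*}

theorem compatible_of_eq_on_inter {p q : κ → Option Bool} (hp : IsCond p) (hq : IsCond q)
    (h : ∀ a, p a ≠ none → q a ≠ none → p a = q a) : Compatible p q := by
  refine ⟨fun a => (p a).or (q a), (hp.union hq).subset fun a ha => ?_, fun a ha => ?_,
    fun a ha => ?_⟩
  · by_contra hn
    simp_all [support]
  · cases hpa : p a <;> simp_all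
  · have hpq := h a
    cases hpa : p a <;> simp_all

theorem IsCond.update [DecidableEq κ] {s : κ → Option Bool} (hs : IsCond s) (a : κ)
    (b : Option Bool) : IsCond (Function.update s a b) := by
  refine (hs.insert a).subset fun x hx => ?_
  by_cases hxa : x = a
  · exact Or.inl hxa
  · exact Or.inr (by simpa [support, hxa] using hx)

/-- A condition `q` compatible with `s` is compatible with every extension of `s` that meets `q`
only inside the support of `s`. -/
theorem Compatible.of_extends {p q s : κ → Option Bool} (hsq : Compatible s q) (hp : IsCond p)
    (hq : IsCond q) (hps : Extends p s) (h : ∀ a, p a ≠ none → q a ≠ none → s a ≠ none) :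
    Compatible p q := by
  obtain ⟨r, -, hrs, hrq⟩ := hsq
  refine compatible_of_eq_on_inter hp hq fun a hpa hqa => ?_
  rw [hps a (h a hpa hqa), ← hrs a (h a hpa hqa), hrq a hqa]

/-- A finite part of a predense set suffices for the extensions of `s` that add at most `n`
points to its support. -/
theorem exists_finite_subset_forall_extends {A : Set (κ → Option Bool)}
    (hA : ∀ q ∈ A, IsCond q) (hpre : ∀ p, IsCond p → ∃ q ∈ A, Compatible p q) (n : ℕ)
    (s : κ → Option Bool) (hs : IsCond s) :
    ∃ L ⊆ A, L.Finite ∧ ∀ p, IsCond p → Extends p s →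
      (support p \ support s).ncard ≤ n → ∃ q ∈ L, Compatible p q := by
  classical
  induction n generalizing s with
  | zero =>
    obtain ⟨q, hqA, hsq⟩ := hpre s hs
    refine ⟨{q}, by simpa using hqA, Set.finite_singleton q, fun p hp hps hcard => ⟨q, rfl, ?_⟩⟩
    refine hsq.of_extends hp (hA q hqA) hps fun a hpa _ hsa => ?_
    have hempty := (Set.ncard_eq_zero (hp.subset Set.sdiff_subset)).1 (Nat.le_zero.1 hcard)
    exact hempty.subset ⟨hpa, not_not.2 hsa⟩
  | succ n ih =>
    obtain ⟨q, hqA, hsq⟩ := hpre s hs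
    choose L hLA hLfin hL using fun (a : κ) (b : Bool) =>
      ih (Function.update s a (some b)) (hs.update a _)
    refine ⟨insert q (⋃ a ∈ support q, ⋃ b, L a b), ?_, ?_, fun p hp hps hcard => ?_⟩
    · exact Set.insert_subset hqA (Set.iUnion₂_subset fun a _ => Set.iUnion_subset (hLA a))
    · exact ((hA q hqA).biUnion fun a _ => Set.finite_iUnion (hLfin a)).insert q
    by_cases h : ∀ a, p a ≠ none → q a ≠ none → s a ≠ none
    · exact ⟨q, Set.mem_insert _ _, hsq.of_extends hp (hA q hqA) hps h⟩
    push Not at h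
    obtain ⟨a, hpa, hqa, hsa⟩ := h
    obtain ⟨b, hb⟩ := Option.ne_none_iff_exists'.1 hpa
    obtain ⟨q', hq', hpq'⟩ := hL a b p hp
      (fun x hx => by by_cases hxa : x = a <;> simp_all [Extends])
      (by
        have hlt : (support p \ support (Function.update s a (some b))).ncard <
            (support p \ support s).ncard := by
          refine Set.ncard_lt_ncard ⟨fun x hx => ?_, fun hsub => ?_⟩
            (hp.subset Set.sdiff_subset)
          · by_cases hxa : x = a <;> simp_all [support]
          · have := hsub ⟨hpa, not_not.2 hsa⟩
            simp [support] at this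
        omega)
    exact ⟨q', Set.mem_insert_of_mem _ (Set.mem_biUnion hqa (Set.mem_iUnion.2 ⟨b, hq'⟩)), hpq'⟩

end Cohen

/-- Kada, claim in the proof of Proposition 5 (after Dow–Tall–Weiss, Lemma 1.0):
for every maximal antichain `A` in the Cohen forcing notion `C(κ)` and every
`n`, there is a finite `L ⊆ A` such that every condition whose support has
size at most `n` is compatible with some member of `L`. -/
theorem cohen_maximalAntichain_finite_subset {κ : Type*} [Infinite κ] (n : ℕ)
    (A : Set (κ → Option Bool)) (hA : Cohen.IsMaximalAntichain A) :
    ∃ L ⊆ A, L.Finite ∧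
      ∀ p, Cohen.IsCond p → (Cohen.support p).ncard ≤ n →
        ∃ q ∈ L, Cohen.Compatible p q := by
  obtain ⟨L, hLA, hLfin, hL⟩ := Cohen.exists_finite_subset_forall_extends hA.1.1 hA.2 n
    (fun _ => none) (by simp [Cohen.IsCond, Cohen.support])
  refine ⟨L, hLA, hLfin, fun p hp hcard => hL p hp (fun _ h => absurd rfl h) ?_⟩
  simpa [Cohen.support] using hcard
end

section
/- Let κ be an infinite type (the index set). The Cohen forcing notion C(κ) is weakly endowed: there exists a sequence ⟨𝓛_n : n < ω⟩ such that for each n < ω: (1) 𝓛_n is a set of finite antichains in C(κ); (2) for every maximal antichain A in C(κ) there is L ∈ 𝓛_n with L ⊆ A; and (3') for every condition p whose support has size at most n and every L ∈ 𝓛_n, there is q ∈ L compatible with p. -/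
namespace Cohen

variable {κ : Type*}

theorem compatible_iff {p q : κ → Option Bool} (hp : IsCond p) (hq : IsCond q) :
    Compatible p q ↔ ∀ a ∈ support q, p a = none ∨ p a = q a := by
  constructor
  · rintro ⟨r, -, hrp, hrq⟩ a ha
    by_cases hpa : p a = none
    · exact Or.inl hpa
    · exact Or.inr ((hrp a hpa).symm.trans (hrq a ha))
  · intro h
    refine ⟨fun a => (p a).or (q a), (hp.union hq).subset fun a ha => ?_, fun a ha => ?_,
      fun a ha => ?_⟩
    · simp only [support, Set.mem_union, Set.mem_ofPred_eq] at ha ⊢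
      by_contra! hc
      simp [hc] at ha
    · cases hpa : p a <;> simp_all
    · rcases h a ha with h | h
      · simp [h]
      · simp [h]

/-- The conditions with support of size at most `n`, given by the sizes of the finite subsets of
the support. -/
theorem isCond_and_ncard_le_iff {p : κ → Option Bool} {n : ℕ} :
    IsCond p ∧ (support p).ncard ≤ n ↔ ∀ s : Finset κ, n < s.card → ∃ a ∈ s, p a = none := by
  constructor
  · rintro ⟨hp, hn⟩ s hs
    by_contra! hc
    have hle : (s : Set κ).ncard ≤ (support p).ncard := Set.ncard_le_ncard (fun a ha => hc a ha) hp
    rw [Set.ncard_coe_finset] at hle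
    omega
  · intro h
    have hfin : IsCond p := by
      by_contra hinf
      obtain ⟨s, hs, hcard⟩ := Set.Infinite.exists_subset_card_eq hinf (n + 1)
      obtain ⟨a, ha, hpa⟩ := h s (by omega)
      exact hs ha hpa
    refine ⟨hfin, ?_⟩
    by_contra! hlt
    rw [Set.ncard_eq_toFinset_card _ hfin] at hlt
    obtain ⟨a, ha, hpa⟩ := h _ hlt
    exact (Set.Finite.mem_toFinset hfin).1 ha hpa

/-- Every maximal antichain has a finite subset predense for the conditions with support of size
at most `n`. This is compactness of that set of conditions in the product of discrete spaces. -/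
theorem IsMaximalAntichain.exists_finite_subset {A : Set (κ → Option Bool)}
    (hA : IsMaximalAntichain A) (n : ℕ) :
    ∃ L ⊆ A, L.Finite ∧
      ∀ p, IsCond p → (support p).ncard ≤ n → ∃ q ∈ L, Compatible p q := by
  let _ : TopologicalSpace (Option Bool) := ⊥
  have : DiscreteTopology (Option Bool) := ⟨rfl⟩
  have hK : IsCompact {p : κ → Option Bool | IsCond p ∧ (support p).ncard ≤ n} := by
    refine IsClosed.isCompact ?_
    simp only [isCond_and_ncard_le_iff, Set.ofPred_forall]
    refine isClosed_iInter fun s => isClosed_iInter fun _ => ?_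
    have hs : {p : κ → Option Bool | ∃ a ∈ s, p a = none} =
        ⋃ a ∈ s, (fun p : κ → Option Bool => p a) ⁻¹' {none} := by
      ext p
      simp
    rw [hs]
    exact isClosed_biUnion_finset fun a _ => (isClosed_discrete _).preimage (continuous_apply a)
  obtain ⟨L, hLA, hL, hcover⟩ := hK.elim_finite_subcover_image (b := A)
    (c := fun q => {p | ∀ a ∈ support q, p a = none ∨ p a = q a})
    (fun q hq => by
      simp only [Set.ofPred_forall]
      exact (hA.1.1 q hq).isOpen_biInter fun a _ => by
        have ha := (isOpen_discrete {x | x = none ∨ x = q a}).preimage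
          (continuous_apply (A := fun _ : κ => Option Bool) a)
        exact ha)
    (fun p hp => by
      obtain ⟨q, hq, hpq⟩ := hA.2 p hp.1
      exact Set.mem_biUnion hq ((compatible_iff hp.1 (hA.1.1 q hq)).1 hpq))
  refine ⟨L, hLA, hL, fun p hp hn => ?_⟩
  obtain ⟨q, hq, hpq⟩ := Set.mem_iUnion₂.1 (hcover ⟨hp, hn⟩)
  exact ⟨q, hq, (compatible_iff hp (hA.1.1 q (hLA hq))).2 hpq⟩

end Cohen

/-- Kada, Proposition 5: the Cohen forcing notion `C(κ)` is weakly endowed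
(with respect to the decomposition into the sets of conditions of support of
size at most `n`). -/
theorem cohen_weakly_endowed {κ : Type*} [Infinite κ] :
    ∃ 𝓛 : ℕ → Set (Set (κ → Option Bool)),
      ∀ n : ℕ,
        (∀ L ∈ 𝓛 n, L.Finite ∧ Cohen.IsAntichain L) ∧
        (∀ A, Cohen.IsMaximalAntichain A → ∃ L ∈ 𝓛 n, L ⊆ A) ∧
        (∀ p, Cohen.IsCond p → (Cohen.support p).ncard ≤ n →
          ∀ L ∈ 𝓛 n, ∃ q ∈ L, Cohen.Compatible p q) := by
  refine ⟨fun n => {L | (L.Finite ∧ Cohen.IsAntichain L) ∧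
    ∀ p, Cohen.IsCond p → (Cohen.support p).ncard ≤ n → ∃ q ∈ L, Cohen.Compatible p q},
    fun n => ⟨fun L hL => hL.1, fun A hA => ?_, fun p hp hn L hL => hL.2 p hp hn⟩⟩
  obtain ⟨L, hLA, hfin, hL⟩ := hA.exists_finite_subset n
  exact ⟨L, ⟨⟨hfin, fun p hp => hA.1.1 p (hLA hp),
    fun p hp q hq => hA.1.2 p (hLA hp) q (hLA hq)⟩, hL⟩, hLA⟩
end

section
/- Let κ be an infinite type (the index set). The Cohen forcing notion C(κ) is endowed: there exists a sequence ⟨𝓛_n : n < ω⟩ such that for each n < ω: (1) 𝓛_n is a set of finite antichains in C(κ); (2) for every maximal antichain A in C(κ) there is L ∈ 𝓛_n with L ⊆ A; and (3) for every condition p whose support has size at most n and any n elements L_0, …, L_{n-1} of 𝓛_n, there are conditions q_0, …, q_{n-1} with q_i ∈ L_i for each i < n such that the set {p, q_0, …, q_{n-1}} has a common lower bound in C(κ) (i.e., a single condition extending p and every q_i). -/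
namespace Cohen

variable {κ : Type*} {p q r s t : κ → Option Bool} {A L : Set (κ → Option Bool)} {n : ℕ}

lemma Extends.trans (h₁ : Extends r q) (h₂ : Extends q p) : Extends r p := fun a ha => by
  rw [h₁ a (by rwa [h₂ a ha]), h₂ a ha]

lemma Extends.support_subset (h : Extends q p) : support p ⊆ support q := fun a ha => by
  simpa [support, h a ha] using ha

/-- Two conditions that agree on the intersection of their supports have a common extension
whose support is no larger than the two supports together. -/
lemma exists_extends_of_agree (hp : IsCond p) (hq : IsCond q)
    (h : ∀ a, p a ≠ none → q a ≠ none → p a = q a) :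
    ∃ r, IsCond r ∧ Extends r p ∧ Extends r q ∧
      (support r).ncard ≤ (support p).ncard + (support q).ncard := by
  have hsub : support (fun a => (p a).or (q a)) ⊆ support p ∪ support q := fun a ha => by
    simp only [support, Set.mem_ofPred_eq, Set.mem_union, ne_eq, Option.or_eq_none_iff] at ha ⊢
    tauto
  refine ⟨fun a => (p a).or (q a), (hp.union hq).subset hsub, fun a ha => ?_, fun a ha => ?_,
    (Set.ncard_le_ncard hsub (hp.union hq)).trans (Set.ncard_union_le _ _)⟩
  · cases hpa : p a <;> simp_all
  · have := h a
    cases hpa : p a <;> simp_all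

lemma Compatible.agree (h : Compatible p q) (a : κ) (hp : p a ≠ none) (hq : q a ≠ none) :
    p a = q a := by
  obtain ⟨r, -, h₁, h₂⟩ := h
  rw [← h₁ a hp, h₂ a hq]

lemma isCond_update [DecidableEq κ] (hs : IsCond s) (a : κ) (b : Option Bool) :
    IsCond (Function.update s a b) := by
  refine (hs.insert a).subset fun c hc => ?_
  by_cases h : c = a
  · exact Or.inl h
  · exact Or.inr (by simpa [support, h] using hc)

/-- A predense set has, for each condition `s` and each `k`, a finite subset that is predense
for the extensions of `s` by at most `k` further values. -/
lemma exists_finite_predense_above (hc : ∀ q ∈ A, IsCond q)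
    (hA : ∀ p, IsCond p → ∃ q ∈ A, Compatible p q) (k : ℕ) :
    ∀ s, IsCond s → ∃ F ⊆ A, F.Finite ∧ ∀ t, IsCond t → Extends t s →
      (support t \ support s).ncard ≤ k → ∃ q ∈ F, Compatible t q := by
  classical
  induction k with
  | zero =>
    intro s hs
    obtain ⟨q, hqA, hsq⟩ := hA s hs
    refine ⟨{q}, by simpa using hqA, Set.finite_singleton q, fun t ht hts hcard => ⟨q, rfl, ?_⟩⟩
    have hsub : support t ⊆ support s := by
      rw [← Set.sdiff_eq_empty, ← Set.ncard_eq_zero (ht.subset Set.sdiff_subset)]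
      omega
    obtain ⟨r, hr, htr, hqr, -⟩ := exists_extends_of_agree ht (hc q hqA) fun a h₁ h₂ => by
      have h₃ : s a ≠ none := hsub h₁
      rw [hts a h₃, hsq.agree a h₃ h₂]
    exact ⟨r, hr, htr, hqr⟩
  | succ k ih =>
    intro s hs
    obtain ⟨q, hqA, hsq⟩ := hA s hs
    have ih' (x : κ × Option Bool) := ih _ (isCond_update hs x.1 x.2)
    choose F hFA hFfin hF using ih'
    refine ⟨{q} ∪ ⋃ x ∈ support q ×ˢ Set.univ, F x, ?_, ?_, ?_⟩
    · exact Set.union_subset (by simpa using hqA) (Set.iUnion₂_subset fun x _ => hFA x)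
    · exact (Set.finite_singleton q).union
        (((hc q hqA).prod Set.finite_univ).biUnion fun x _ => hFfin x)
    · intro t ht hts hcard
      by_cases h : ∀ a, t a ≠ none → q a ≠ none → s a ≠ none
      · obtain ⟨r, hr, htr, hqr, -⟩ := exists_extends_of_agree ht (hc q hqA) fun a h₁ h₂ => by
          rw [hts a (h a h₁ h₂), hsq.agree a (h a h₁ h₂) h₂]
        exact ⟨q, Or.inl rfl, r, hr, htr, hqr⟩
      · push Not at h
        obtain ⟨a, hta, hqa, hsa⟩ := h
        obtain ⟨q', hq', hcomp⟩ := hF (a, t a) t ht (fun c hc => by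
          by_cases hca : c = a
          · simp [hca]
          · simp only [Function.update_of_ne hca] at hc ⊢
            exact hts c hc) (by
          have hsub : support t \ support (Function.update s a (t a)) ⊂
              support t \ support s := by
            have hsubset : support t \ support (Function.update s a (t a)) ⊆
                support t \ support s := fun c hc => ⟨hc.1, fun hcs => hc.2 (by
              by_cases hca : c = a
              · exact absurd hsa (hca ▸ hcs)
              · simpa [support, hca] using hcs)⟩
            exact (Set.ssubset_iff_of_subset hsubset).2
              ⟨a, ⟨hta, by simpa [support] using hsa⟩, fun h => h.2 (by simpa [support] using hta)⟩
          have := Set.ncard_lt_ncard hsub (ht.subset Set.sdiff_subset)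
          exact Nat.lt_succ_iff.1 (this.trans_le hcard))
        exact ⟨q', Or.inr (Set.mem_biUnion (Set.mk_mem_prod hqa (Set.mem_univ _)) hq'), hcomp⟩

lemma exists_finite_predense (hc : ∀ q ∈ A, IsCond q)
    (hA : ∀ p, IsCond p → ∃ q ∈ A, Compatible p q) (k : ℕ) :
    ∃ F ⊆ A, F.Finite ∧ ∀ t, IsCond t → (support t).ncard ≤ k → ∃ q ∈ F, Compatible t q := by
  obtain ⟨F, hFA, hF, h⟩ :=
    exists_finite_predense_above hc hA k (fun _ => none) (by simp [IsCond, support])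
  exact ⟨F, hFA, hF, fun t ht hcard => h t ht (fun a ha => absurd rfl ha)
    (by simpa [support] using hcard)⟩

/-- `m` bounds the sizes of conditions that can be met successively, `n` times, inside `L`:
a condition of size at most `m j` is compatible with a member of `L` so small that their union
has size at most `m (j + 1)`. -/
def IsGrowthBound (n : ℕ) (L : Set (κ → Option Bool)) (m : ℕ → ℕ) : Prop :=
  m 0 = n ∧ ∀ j < n, ∀ p, IsCond p → (support p).ncard ≤ m j →
    ∃ q ∈ L, Compatible p q ∧ m j + (support q).ncard ≤ m (j + 1)

lemma exists_finite_isGrowthBound (hc : ∀ q ∈ A, IsCond q)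
    (hA : ∀ p, IsCond p → ∃ q ∈ A, Compatible p q) (n : ℕ) :
    ∃ L ⊆ A, L.Finite ∧ ∃ m, IsGrowthBound n L m := by
  choose F hFA hFfin hF using exists_finite_predense hc hA
  have hbd (k : ℕ) : ∃ b, ∀ q ∈ F k, (support q).ncard ≤ b := by
    obtain ⟨b, hb⟩ := ((hFfin k).image fun q => (support q).ncard).bddAbove
    exact ⟨b, fun q hq => hb ⟨q, hq, rfl⟩⟩
  choose b hb using hbd
  let m : ℕ → ℕ := fun j => Nat.rec n (fun _ k => k + b k) j
  refine ⟨⋃ j ∈ Set.Iio n, F (m j), Set.iUnion₂_subset fun j _ => hFA _,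
    (Set.finite_Iio n).biUnion fun j _ => hFfin _, m, rfl, fun j hj p hp hcard => ?_⟩
  obtain ⟨q, hq, hpq⟩ := hF (m j) p hp hcard
  exact ⟨q, Set.mem_biUnion hj hq, hpq, Nat.add_le_add_left (hb _ q hq) _⟩

/-- Members of `n` sets with growth bounds can be met one set at a time, by always choosing next
the set whose growth bound is least. -/
lemma exists_partial_choice {L : Fin n → Set (κ → Option Bool)} {m : Fin n → ℕ → ℕ}
    (hc : ∀ i, ∀ q ∈ L i, IsCond q) (hm : ∀ i, IsGrowthBound n (L i) (m i))
    (hp : IsCond p) (hcard : (support p).ncard ≤ n) (j : ℕ) (hj : j ≤ n) :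
    ∃ T : Finset (Fin n), T.card = j ∧ ∃ r, IsCond r ∧ Extends r p ∧
      (∀ i ∈ T, ∃ q ∈ L i, Extends r q) ∧ ∀ i ∉ T, (support r).ncard ≤ m i j := by
  induction j with
  | zero =>
    exact ⟨∅, rfl, p, hp, fun _ _ => rfl, by simp, fun i _ => by rwa [(hm i).1]⟩
  | succ j ih =>
    obtain ⟨T, hT, r, hr, hrp, hrq, hrm⟩ := ih (by omega)
    have hne : Tᶜ.Nonempty := by
      rw [← Finset.card_pos, Finset.card_compl, Fintype.card_fin]
      omega
    obtain ⟨i, hi, hmin⟩ := Tᶜ.exists_min_image (fun i => m i (j + 1)) hne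
    rw [Finset.mem_compl] at hi
    obtain ⟨q, hq, hcomp, hle⟩ := (hm i).2 j (by omega) r hr (hrm i hi)
    obtain ⟨r', hr', hrr', hqr', hcard'⟩ := exists_extends_of_agree hr (hc i q hq) hcomp.agree
    refine ⟨insert i T, by rw [Finset.card_insert_of_notMem hi, hT], r', hr', hrr'.trans hrp,
      fun i' hi' => ?_, fun i' hi' => ?_⟩
    · obtain rfl | hi' := Finset.mem_insert.1 hi'
      · exact ⟨q, hq, hqr'⟩
      · obtain ⟨q', hq', hext⟩ := hrq i' hi'
        exact ⟨q', hq', hrr'.trans hext⟩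
    · have h₁ := hmin i' (by simp_all)
      have h₂ := hrm i hi
      omega

end Cohen

/-- Dow's Lemma (Dow–Tall–Weiss, Lemma 1.1): the Cohen forcing notion `C(κ)`
is endowed (with respect to the decomposition into the sets of conditions of
support of size at most `n`). -/
theorem cohen_endowed {κ : Type*} [Infinite κ] :
    ∃ 𝓛 : ℕ → Set (Set (κ → Option Bool)),
      ∀ n : ℕ,
        (∀ L ∈ 𝓛 n, L.Finite ∧ Cohen.IsAntichain L) ∧
        (∀ A, Cohen.IsMaximalAntichain A → ∃ L ∈ 𝓛 n, L ⊆ A) ∧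
        (∀ p, Cohen.IsCond p → (Cohen.support p).ncard ≤ n →
          ∀ L : Fin n → Set (κ → Option Bool), (∀ i, L i ∈ 𝓛 n) →
            ∃ q : Fin n → (κ → Option Bool), (∀ i, q i ∈ L i) ∧
              ∃ r, Cohen.IsCond r ∧ Cohen.Extends r p ∧
                ∀ i, Cohen.Extends r (q i)) := by
  refine ⟨fun n => {L | L.Finite ∧ Cohen.IsAntichain L ∧ ∃ m, Cohen.IsGrowthBound n L m},
    fun n => ⟨fun L hL => ⟨hL.1, hL.2.1⟩, fun A hA => ?_, fun p hp hcard L hL => ?_⟩⟩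
  · obtain ⟨L, hLA, hfin, hm⟩ := Cohen.exists_finite_isGrowthBound hA.1.1 hA.2 n
    exact ⟨L, ⟨hfin, ⟨fun p hp => hA.1.1 p (hLA hp),
      fun p hp q hq => hA.1.2 p (hLA hp) q (hLA hq)⟩, hm⟩, hLA⟩
  · choose m hm using fun i => (hL i).2.2
    obtain ⟨T, hT, r, hr, hrp, hrq, -⟩ :=
      Cohen.exists_partial_choice (fun i => (hL i).2.1.1) hm hp hcard n le_rfl
    have hTuniv : T = Finset.univ := by simpa [← Finset.card_eq_iff_eq_univ] using hT
    choose q hq hext using fun i => hrq i (hTuniv ▸ Finset.mem_univ i)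
    exact ⟨q, hq, r, hr, hrp, hext⟩
end

section
/- Let (Ω, μ) be a probability space. Its measure algebra is weakly endowed: there exists a sequence ⟨𝓛_n : n < ω⟩ such that for each n < ω: (1) 𝓛_n is a set of finite antichains (finite families of measurable sets of positive measure, pairwise intersecting in measure zero); (2) for every maximal antichain A in the measure algebra there is L ∈ 𝓛_n with L ⊆ A; and (3') for every measurable set p with μ(p) ≥ 2^{−n} and every L ∈ 𝓛_n, there is q ∈ L with μ(p ∩ q) > 0. -/
open MeasureTheory ENNReal

namespace MeasureAlgebra

variable {Ω : Type*} [MeasurableSpace Ω]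

/-- A condition in the measure algebra of `μ`: a measurable set of positive
measure. -/
def IsCond (μ : Measure Ω) (p : Set Ω) : Prop := MeasurableSet p ∧ 0 < μ p

/-- Two conditions are compatible if their intersection has positive measure. -/
def Compatible (μ : Measure Ω) (p q : Set Ω) : Prop := 0 < μ (p ∩ q)

/-- An antichain in the measure algebra: a family of conditions which are
pairwise incompatible (distinct members intersect in measure zero). -/
def IsAntichain (μ : Measure Ω) (A : Set (Set Ω)) : Prop :=
  (∀ p ∈ A, IsCond μ p) ∧ ∀ p ∈ A, ∀ q ∈ A, p ≠ q → μ (p ∩ q) = 0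

/-- A maximal antichain in the measure algebra: an antichain such that every
condition is compatible with some member. -/
def IsMaximalAntichain (μ : Measure Ω) (A : Set (Set Ω)) : Prop :=
  IsAntichain μ A ∧ ∀ p, IsCond μ p → ∃ q ∈ A, Compatible μ p q

end MeasureAlgebra

namespace MeasureAlgebra

variable {Ω : Type*} [MeasurableSpace Ω] {μ : Measure Ω}

theorem IsAntichain.countable [IsFiniteMeasure μ] {A : Set (Set Ω)} (hA : IsAntichain μ A) :
    A.Countable := by
  have h := Measure.countable_meas_pos_of_disjoint_iUnion₀ (μ := μ) (As := fun p : A => (p : Set Ω))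
    (fun p => (hA.1 p p.2).1.nullMeasurableSet)
    (fun p q hpq => hA.2 p p.2 q q.2 (Subtype.coe_ne_coe.2 hpq))
  have huniv : {p : A | 0 < μ (p : Set Ω)} = Set.univ :=
    Set.eq_univ_of_forall fun p => (hA.1 p p.2).2
  rw [huniv, Set.countable_univ_iff] at h
  exact h

theorem IsAntichain.mono {A B : Set (Set Ω)} (hA : IsAntichain μ A) (hBA : B ⊆ A) :
    IsAntichain μ B :=
  ⟨fun p hp => hA.1 p (hBA hp), fun p hp q hq => hA.2 p (hBA hp) q (hBA hq)⟩

theorem IsMaximalAntichain.measure_compl_sUnion [IsFiniteMeasure μ] {A : Set (Set Ω)}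
    (hA : IsMaximalAntichain μ A) : μ (⋃₀ A)ᶜ = 0 := by
  by_contra h
  have hmeas : MeasurableSet (⋃₀ A) :=
    MeasurableSet.sUnion hA.1.countable fun p hp => (hA.1.1 p hp).1
  obtain ⟨q, hq, hpos⟩ := hA.2 (⋃₀ A)ᶜ ⟨hmeas.compl, pos_iff_ne_zero.2 h⟩
  refine hpos.ne' ?_
  rw [(Set.disjoint_compl_left_iff_subset.2 (Set.subset_sUnion_of_mem hq)).inter_eq, measure_empty]

/-- Finite parts of a maximal antichain cover all but arbitrarily small measure. -/
theorem IsMaximalAntichain.exists_finite_subset [IsFiniteMeasure μ] {A : Set (Set Ω)}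
    (hA : IsMaximalAntichain μ A) {ε : ℝ≥0∞} (hε : 0 < ε) :
    ∃ L ⊆ A, L.Finite ∧ μ (⋃₀ L)ᶜ < ε := by
  have : Countable A := hA.1.countable
  have hmeas (F : Finset A) : MeasurableSet (⋃ p ∈ F, (p : Set Ω)) :=
    F.measurableSet_biUnion fun p _ => (hA.1.1 p p.2).1
  have hanti : Antitone fun F : Finset A => (⋃ p ∈ F, (p : Set Ω))ᶜ := fun F G hFG =>
    Set.compl_subset_compl.2 (Set.biUnion_subset_biUnion_left hFG)
  have hinf : ⨅ F : Finset A, μ (⋃ p ∈ F, (p : Set Ω))ᶜ = 0 := by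
    rw [← hanti.directed_ge.measure_iInter (fun F => (hmeas F).compl.nullMeasurableSet)
      ⟨∅, measure_ne_top μ _⟩, ← Set.compl_iUnion, ← hA.measure_compl_sUnion,
      ← Set.iUnion_eq_iUnion_finset, Set.sUnion_eq_iUnion]
  obtain ⟨F, hF⟩ := iInf_lt_iff.1 (hinf.trans_lt hε)
  refine ⟨Subtype.val '' (F : Set A), Subtype.coe_image_subset _ _, F.finite_toSet.image _, ?_⟩
  simpa only [Set.sUnion_image, Finset.mem_coe] using hF

/-- A countable family missing less measure than `p` has a member compatible with `p`. -/
theorem exists_compatible_of_measure_compl_lt {L : Set (Set Ω)} (hL : L.Countable) {p : Set Ω}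
    (hp : μ (⋃₀ L)ᶜ < μ p) : ∃ q ∈ L, Compatible μ p q := by
  by_contra! h
  have hzero : μ (p ∩ ⋃₀ L) = 0 := by
    rw [Set.sUnion_eq_biUnion, Set.inter_iUnion₂, measure_biUnion_null_iff hL]
    exact fun q hq => nonpos_iff_eq_zero.1 (not_lt.1 (h q hq))
  refine hp.not_ge ?_
  calc μ p ≤ μ (p ∩ ⋃₀ L) + μ (p \ ⋃₀ L) := measure_le_inter_add_sdiff μ p _
    _ ≤ μ (⋃₀ L)ᶜ := by
      rw [hzero, zero_add]
      exact measure_mono fun x hx => hx.2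

end MeasureAlgebra


/-- Kada, Theorem: the measure algebra of a probability space is weakly
endowed (with respect to the decomposition into the sets of conditions of
measure at least `2⁻ⁿ`). -/
theorem measureAlgebra_weakly_endowed
    {Ω : Type*} [MeasurableSpace Ω] (μ : MeasureTheory.Measure Ω)
    [MeasureTheory.IsProbabilityMeasure μ] :
    ∃ 𝓛 : ℕ → Set (Set (Set Ω)),
      ∀ n : ℕ,
        (∀ L ∈ 𝓛 n, L.Finite ∧ MeasureAlgebra.IsAntichain μ L) ∧
        (∀ A, MeasureAlgebra.IsMaximalAntichain μ A → ∃ L ∈ 𝓛 n, L ⊆ A) ∧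
        (∀ p : Set Ω, MeasurableSet p → 2⁻¹ ^ n ≤ μ p →
          ∀ L ∈ 𝓛 n, ∃ q ∈ L, 0 < μ (p ∩ q)) := by
  refine ⟨fun n => {L | (L.Finite ∧ MeasureAlgebra.IsAntichain μ L) ∧ μ (⋃₀ L)ᶜ < 2⁻¹ ^ n},
    fun n => ⟨fun L hL => hL.1, fun A hA => ?_, fun p _ hp L hL => ?_⟩⟩
  · have hpos : (0 : ℝ≥0∞) < 2⁻¹ ^ n := ENNReal.pow_pos (by simp) n
    obtain ⟨L, hLA, hfin, hlt⟩ := hA.exists_finite_subset hpos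
    exact ⟨L, ⟨⟨hfin, hA.1.mono hLA⟩, hlt⟩, hLA⟩
  · exact MeasureAlgebra.exists_compatible_of_measure_compl_lt hL.1.1.countable (hL.2.trans_le hp)
end
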